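/- arXiv:1807.06351 — 2 statements merged into one kernel-verified Lean document; each statement's English description precedes it below -/
import Mathlib

section
/- For every μ ∈ [0,1], 0 is a regular value of W: for every q ∈ ℝ² ∖ {e,s} with W(q) = 0, the differential dW(q) is nonzero. -/
open Real Set

/-- The factor `W(q) = μ/‖q-e‖³ + (1-μ)/‖q-s‖³ - 1` of the partial derivative
`∂V/∂q₂ = q₂·W` of the effective potential of the PCR3BP. -/
noncomputable def W (μ : ℝ) (q : ℝ × ℝ) : ℝ :=
  μ / Real.sqrt ((q.1 - (1 - μ)) ^ 2 + q.2 ^ 2) ^ 3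
    + (1 - μ) / Real.sqrt ((q.1 + μ) ^ 2 + q.2 ^ 2) ^ 3 - 1

/-- Partial derivative `∂W/∂q₁`. -/
noncomputable def Wq1 (μ : ℝ) (q : ℝ × ℝ) : ℝ := deriv (fun a => W μ (a, q.2)) q.1

/-- Partial derivative `∂W/∂q₂`. -/
noncomputable def Wq2 (μ : ℝ) (q : ℝ × ℝ) : ℝ := deriv (fun b => W μ (q.1, b)) q.2

/-- The derivative of `c / √f ^ 3` where `f` is positive. -/
theorem HasDerivAt.const_div_sqrt_pow_three {f : ℝ → ℝ} {f' x : ℝ} (c : ℝ)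
    (hf : HasDerivAt f f' x) (hx : 0 < f x) :
    HasDerivAt (fun t => c / √(f t) ^ 3) (-(3 / 2) * (c * f' / √(f x) ^ 5)) x := by
  have hr : √(f x) ≠ 0 := (Real.sqrt_pos.2 hx).ne'
  refine ((hasDerivAt_const x c).div ((hf.sqrt hx.ne').pow 3) (pow_ne_zero 3 hr)).congr_deriv ?_
  simp only [Pi.pow_apply]
  field_simp
  norm_num
  ring

theorem sq_sub_add_sq_pos_of_ne {q : ℝ × ℝ} {c : ℝ} (h : q ≠ (c, 0)) :
    0 < (q.1 - c) ^ 2 + q.2 ^ 2 := by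
  by_contra! hle
  have h₁ : q.1 - c = 0 := by nlinarith [sq_nonneg (q.1 - c), sq_nonneg q.2]
  have h₂ : q.2 = 0 := by nlinarith [sq_nonneg (q.1 - c), sq_nonneg q.2]
  exact h (Prod.ext (sub_eq_zero.1 h₁) h₂)

theorem Wq1_eq {μ : ℝ} {q : ℝ × ℝ} (he : 0 < (q.1 - (1 - μ)) ^ 2 + q.2 ^ 2)
    (hs : 0 < (q.1 + μ) ^ 2 + q.2 ^ 2) :
    Wq1 μ q = -3 * (μ * (q.1 - (1 - μ)) / √((q.1 - (1 - μ)) ^ 2 + q.2 ^ 2) ^ 5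
      + (1 - μ) * (q.1 + μ) / √((q.1 + μ) ^ 2 + q.2 ^ 2) ^ 5) := by
  have h₁ := ((((hasDerivAt_id q.1).sub_const (1 - μ)).pow 2).add_const
    (q.2 ^ 2)).const_div_sqrt_pow_three μ he
  have h₂ := ((((hasDerivAt_id q.1).add_const μ).pow 2).add_const
    (q.2 ^ 2)).const_div_sqrt_pow_three (1 - μ) hs
  refine (((h₁.add h₂).sub_const 1).deriv).trans ?_
  simp only [Pi.pow_apply, id]
  push_cast
  ring

theorem Wq2_eq {μ : ℝ} {q : ℝ × ℝ} (he : 0 < (q.1 - (1 - μ)) ^ 2 + q.2 ^ 2)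
    (hs : 0 < (q.1 + μ) ^ 2 + q.2 ^ 2) :
    Wq2 μ q = -3 * q.2 * (μ / √((q.1 - (1 - μ)) ^ 2 + q.2 ^ 2) ^ 5
      + (1 - μ) / √((q.1 + μ) ^ 2 + q.2 ^ 2) ^ 5) := by
  have h₁ := (((hasDerivAt_id q.2).pow 2).const_add
    ((q.1 - (1 - μ)) ^ 2)).const_div_sqrt_pow_three μ he
  have h₂ := (((hasDerivAt_id q.2).pow 2).const_add
    ((q.1 + μ) ^ 2)).const_div_sqrt_pow_three (1 - μ) hs
  refine (((h₁.add h₂).sub_const 1).deriv).trans ?_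
  simp only [Pi.pow_apply, id]
  push_cast
  ring

/-- A convex combination of two positive numbers is positive. -/
theorem convex_comb_pos {μ a b : ℝ} (hμ : μ ∈ Icc (0 : ℝ) 1) (ha : 0 < a) (hb : 0 < b) :
    0 < μ * a + (1 - μ) * b :=
  convex_Ioi (0 : ℝ) ha hb hμ.1 (sub_nonneg.2 hμ.2) (add_sub_cancel μ 1)

/-- At a critical point of `W` on the axis through the primaries, `W` is positive. -/
theorem W_pos_of_critical_on_axis {μ x : ℝ} (hμ : μ ∈ Icc (0 : ℝ) 1) (he : x - (1 - μ) ≠ 0)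
    (hs : x + μ ≠ 0)
    (h : μ * (x - (1 - μ)) / |x - (1 - μ)| ^ 5 + (1 - μ) * (x + μ) / |x + μ| ^ 5 = 0) :
    0 < μ / |x - (1 - μ)| ^ 3 + (1 - μ) / |x + μ| ^ 3 - 1 := by
  have hA : 0 < 1 / |x - (1 - μ)| ^ 5 := by positivity
  have hB : 0 < 1 / |x + μ| ^ 5 := by positivity
  have h' : μ * ((x - (1 - μ)) * (1 / |x - (1 - μ)| ^ 5))
      + (1 - μ) * ((x + μ) * (1 / |x + μ| ^ 5)) = 0 := by
    rw [← h]; ring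
  have hb : 0 < x + μ := by
    by_contra! hle
    have := convex_comb_pos hμ (mul_pos (a := -(x - (1 - μ))) (by linarith) hA)
      (mul_pos (a := -(x + μ)) (neg_pos.2 (lt_of_le_of_ne hle hs)) hB)
    linarith
  have ha : x - (1 - μ) < 0 := by
    by_contra! hle
    have := convex_comb_pos hμ (mul_pos (lt_of_le_of_ne hle he.symm) hA) (mul_pos hb hB)
    linarith
  rw [abs_of_neg ha, abs_of_pos hb]
  have h₁ : 1 < 1 / (-(x - (1 - μ))) ^ 3 :=
    one_lt_one_div (pow_pos (neg_pos.2 ha) 3)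
      (pow_lt_one₀ (neg_pos.2 ha).le (by linarith) three_ne_zero)
  have h₂ : 1 < 1 / (x + μ) ^ 3 :=
    one_lt_one_div (pow_pos hb 3) (pow_lt_one₀ hb.le (by linarith) three_ne_zero)
  have := convex_comb_pos hμ (sub_pos.2 h₁) (sub_pos.2 h₂)
  rw [div_eq_mul_one_div μ, div_eq_mul_one_div (1 - μ)]
  linarith

/-- For every mass ratio `μ ∈ [0,1]`, `0` is a regular value of `W`: at every zero of `W`
the differential of `W` is nonzero. -/
theorem zero_regular_value_of_W (μ : ℝ) (hμ : μ ∈ Icc (0 : ℝ) 1)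
    (q : ℝ × ℝ) (he : q ≠ (1 - μ, 0)) (hs : q ≠ (-μ, 0)) (hW : W μ q = 0) :
    Wq1 μ q ≠ 0 ∨ Wq2 μ q ≠ 0 := by
  by_contra! hcrit
  obtain ⟨h₁, h₂⟩ := hcrit
  have pe := sq_sub_add_sq_pos_of_ne he
  have ps := sq_sub_add_sq_pos_of_ne hs
  rw [sub_neg_eq_add] at ps
  rw [Wq1_eq pe ps] at h₁
  rw [Wq2_eq pe ps] at h₂
  have hpos := convex_comb_pos hμ (one_div_pos.2 (pow_pos (Real.sqrt_pos.2 pe) 5))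
    (one_div_pos.2 (pow_pos (Real.sqrt_pos.2 ps) 5))
  rw [mul_one_div, mul_one_div] at hpos
  have hy : q.2 = 0 := by simpa [hpos.ne'] using h₂
  simp only [W, hy, ne_eq, OfNat.ofNat_ne_zero, not_false_eq_true, zero_pow, add_zero,
    Real.sqrt_sq_eq_abs] at h₁ hW pe ps
  exact (W_pos_of_critical_on_axis hμ (sq_pos_iff.1 pe) (sq_pos_iff.1 ps) (by linarith)).ne' hW
end

section
/- Let μ ∈ (0,1), let ℓ₂ ∈ (1-μ, ∞) and ℓ₃ ∈ (-∞, -μ) be the unique critical points of u in these intervals, and let c < u(ℓ₂) and c < u(ℓ₃). Then for every q in the bounded Hill's region 𝔎_c^b, one has ∂V/∂q₂(q) = 0 if and only if q₂ = 0; i.e., inside the bounded Hill's region for any energy below the second critical value, the roots of ∂V/∂q₂ are precisely the points on the q₁-axis. -/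
open Real Set

/-- The effective potential of the planar circular restricted three-body problem. -/
noncomputable def V (μ : ℝ) (q : ℝ × ℝ) : ℝ :=
  -μ / Real.sqrt ((q.1 - (1 - μ)) ^ 2 + q.2 ^ 2)
    - (1 - μ) / Real.sqrt ((q.1 + μ) ^ 2 + q.2 ^ 2)
    - (q.1 ^ 2 + q.2 ^ 2) / 2

/-- The restriction of the effective potential to the `q₁`-axis. -/
noncomputable def u (μ : ℝ) (x : ℝ) : ℝ :=
  -μ / |x - (1 - μ)| - (1 - μ) / |x + μ| - x ^ 2 / 2

/-- Partial derivative `∂V/∂q₂`. -/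
noncomputable def Vq2 (μ : ℝ) (q : ℝ × ℝ) : ℝ := deriv (fun b => V μ (q.1, b)) q.2

/-- The contribution of a primary of unit mass at distance `r` to minus the effective potential. -/
noncomputable def radialPotential (r : ℝ) : ℝ := r⁻¹ + r ^ 2 / 2

lemma radialPotential_le_of_le_one {a r : ℝ} (ha : 0 < a) (har : a ≤ r) (hr : r ≤ 1) :
    radialPotential r ≤ radialPotential a := by
  have hr0 : 0 < r := ha.trans_le har
  have h1 : 1 ≤ (a * r)⁻¹ := (one_le_inv₀ (by positivity)).2 (by nlinarith)
  have h2 : radialPotential a - radialPotential r = (r - a) * ((a * r)⁻¹ - (a + r) / 2) := by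
    unfold radialPotential
    field_simp
    ring
  nlinarith [mul_nonneg (sub_nonneg.2 har) (by linarith : 0 ≤ (a * r)⁻¹ - (a + r) / 2)]

lemma radialPotential_le_of_one_le {r b : ℝ} (hr : 1 ≤ r) (hrb : r ≤ b) :
    radialPotential r ≤ radialPotential b := by
  have hr0 : 0 < r := by linarith
  have hb0 : 0 < b := by linarith
  have h1 : (b * r)⁻¹ ≤ 1 := inv_le_one_of_one_le₀ (by nlinarith)
  have h2 : radialPotential b - radialPotential r = (b - r) * ((b + r) / 2 - (b * r)⁻¹) := by
    unfold radialPotential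
    field_simp
    ring
  nlinarith [mul_nonneg (sub_nonneg.2 hrb) (by linarith : 0 ≤ (b + r) / 2 - (b * r)⁻¹)]

/-- At a collinear critical point beyond the primary of mass `m`, at distance `a` from it,
the vertical force factor is positive. -/
lemma one_lt_of_collinear_critical {m a : ℝ} (hm : m < 1) (ha : 0 < a)
    (hcrit : m / a ^ 2 + (1 - m) / (a + 1) ^ 2 = m * a + (1 - m) * (a + 1)) :
    1 < m * (a ^ 3)⁻¹ + (1 - m) * ((a + 1) ^ 3)⁻¹ := by
  have hB : ((a + 1) ^ 3)⁻¹ < 1 := inv_lt_one_of_one_lt₀ (by nlinarith [pow_pos ha 3, pow_pos ha 2])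
  have h1 : m / a ^ 2 = a * (m * (a ^ 3)⁻¹) := by field_simp
  have h2 : (1 - m) / (a + 1) ^ 2 = (a + 1) * ((1 - m) * ((a + 1) ^ 3)⁻¹) := by field_simp
  rw [h1, h2] at hcrit
  have h3 : 0 < (1 - m) * (1 - ((a + 1) ^ 3)⁻¹) := mul_pos (by linarith) (by linarith)
  have h4 : 0 < a * (m * (a ^ 3)⁻¹ + (1 - m) * ((a + 1) ^ 3)⁻¹ - 1) := by nlinarith
  have := pos_of_mul_pos_right h4 ha.le
  linarith

/-- On the boundary of the region where the vertical force factor is positive and the distance to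
the far primary is less than `a + 1`, the potential is at least its value at the collinear
critical point. -/
lemma radialPotential_barrier {m a r R : ℝ} (hm0 : 0 < m) (hm1 : m < 1) (ha : 0 < a)
    (hcrit : m / a ^ 2 + (1 - m) / (a + 1) ^ 2 = m * a + (1 - m) * (a + 1))
    (hr : 0 < r) (hr1 : r ≤ 1) (hR1 : 1 ≤ R) (htri : R ≤ r + 1) (hRa : R ≤ a + 1)
    (hbd : R = a + 1 ∨ m * (r ^ 3)⁻¹ + (1 - m) * (R ^ 3)⁻¹ = 1) :
    m * radialPotential r + (1 - m) * radialPotential R ≤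
      m * radialPotential a + (1 - m) * radialPotential (a + 1) := by
  have har : a ≤ r := by
    rcases hbd with h | h
    · linarith
    · by_contra! hlt
      have h1 : (a ^ 3)⁻¹ ≤ (r ^ 3)⁻¹ := by gcongr
      have h2 : ((a + 1) ^ 3)⁻¹ ≤ (R ^ 3)⁻¹ := by gcongr
      have h3 := one_lt_of_collinear_critical hm1 ha hcrit
      have h4 := mul_le_mul_of_nonneg_left h1 hm0.le
      have h5 := mul_le_mul_of_nonneg_left h2 (sub_nonneg.2 hm1.le)
      linarith
  have h1 := mul_le_mul_of_nonneg_left (radialPotential_le_of_le_one ha har hr1) hm0.le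
  have h2 := mul_le_mul_of_nonneg_left (radialPotential_le_of_one_le hR1 hRa) (sub_nonneg.2 hm1.le)
  linarith

/-- The distance from `q` to the point `(x, 0)`. -/
noncomputable def axisDist (x : ℝ) (q : ℝ × ℝ) : ℝ := √((q.1 - x) ^ 2 + q.2 ^ 2)

lemma continuous_axisDist (x : ℝ) : Continuous (axisDist x) := by
  unfold axisDist
  fun_prop

lemma axisDist_sq (x : ℝ) (q : ℝ × ℝ) : axisDist x q ^ 2 = (q.1 - x) ^ 2 + q.2 ^ 2 :=
  Real.sq_sqrt (by positivity)

lemma axisDist_nonneg (x : ℝ) (q : ℝ × ℝ) : 0 ≤ axisDist x q := Real.sqrt_nonneg _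

lemma axisDist_self (x : ℝ) : axisDist x (x, 0) = 0 := by simp [axisDist]

lemma axisDist_pos {x : ℝ} {q : ℝ × ℝ} (h : q ≠ (x, 0)) : 0 < axisDist x q := by
  refine (axisDist_nonneg x q).lt_of_ne' fun h0 => h ?_
  have := axisDist_sq x q
  rw [h0] at this
  have h1 : q.1 - x = 0 := by nlinarith [sq_nonneg (q.1 - x), sq_nonneg q.2]
  have h2 : q.2 = 0 := by nlinarith [sq_nonneg (q.1 - x), sq_nonneg q.2]
  exact Prod.ext (by simpa using sub_eq_zero.1 h1) h2

lemma axisDist_le_add_one {x y : ℝ} (hxy : (x - y) ^ 2 = 1) (q : ℝ × ℝ) :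
    axisDist x q ≤ axisDist y q + 1 := by
  refine le_of_sq_le_sq ?_ (by linarith [axisDist_nonneg y q])
  have h1 : |q.1 - y| ≤ axisDist y q := by
    refine Real.abs_le_sqrt ?_
    nlinarith [sq_nonneg q.2]
  have h2 : |x - y| = 1 := by rw [← sq_abs] at hxy; nlinarith [abs_nonneg (x - y)]
  have h3 : -((q.1 - y) * (x - y)) ≤ |q.1 - y| := by
    calc _ ≤ |(q.1 - y) * (x - y)| := neg_le_abs _
      _ = _ := by rw [abs_mul, h2, mul_one]
  have h4 := axisDist_sq x q
  have h5 := axisDist_sq y q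
  nlinarith

lemma V_eq_radialPotential (μ : ℝ) (q : ℝ × ℝ) :
    V μ q = μ * (1 - μ) / 2 - (μ * radialPotential (axisDist (1 - μ) q) +
      (1 - μ) * radialPotential (axisDist (-μ) q)) := by
  have h1 := axisDist_sq (1 - μ) q
  have h2 := axisDist_sq (-μ) q
  have hV : V μ q = -μ / axisDist (1 - μ) q - (1 - μ) / axisDist (-μ) q
      - (q.1 ^ 2 + q.2 ^ 2) / 2 := by
    simp [V, axisDist]
  rw [hV, radialPotential, radialPotential, h1, h2]
  ring

/-- The factor `g` in `∂V/∂q₂ = q₂ * g`. -/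
noncomputable def verticalFactor (μ : ℝ) (q : ℝ × ℝ) : ℝ :=
  μ * (axisDist (1 - μ) q ^ 3)⁻¹ + (1 - μ) * (axisDist (-μ) q ^ 3)⁻¹ - 1

lemma hasDerivAt_inv_axisDist {x a b : ℝ} (h : 0 < axisDist x (a, b)) :
    HasDerivAt (fun t => (axisDist x (a, t))⁻¹) (-(b * (axisDist x (a, b) ^ 3)⁻¹)) b := by
  have hS : (a - x) ^ 2 + b ^ 2 ≠ 0 := (Real.sqrt_pos.1 h).ne'
  have h1 : HasDerivAt (fun t : ℝ => (a - x) ^ 2 + t ^ 2) (2 * b) b := by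
    simpa using ((hasDerivAt_id b).pow 2).const_add ((a - x) ^ 2)
  refine ((h1.sqrt hS).inv h.ne').congr_deriv ?_
  change -(2 * b / (2 * axisDist x (a, b))) / axisDist x (a, b) ^ 2 = _
  field_simp

lemma Vq2_eq_mul_verticalFactor {μ : ℝ} {q : ℝ × ℝ} (h1 : q ≠ (1 - μ, 0)) (h2 : q ≠ (-μ, 0)) :
    Vq2 μ q = q.2 * verticalFactor μ q := by
  have hV : (fun b => V μ (q.1, b)) = fun b => -μ * (axisDist (1 - μ) (q.1, b))⁻¹
      - (1 - μ) * (axisDist (-μ) (q.1, b))⁻¹ - (q.1 ^ 2 + b ^ 2) / 2 := by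
    funext b
    simp [V, axisDist, div_eq_mul_inv]
  have h3 : HasDerivAt (fun t : ℝ => (q.1 ^ 2 + t ^ 2) / 2) q.2 q.2 := by
    simpa using (((hasDerivAt_id q.2).pow 2).const_add (q.1 ^ 2)).div_const 2
  rw [Vq2, hV]
  refine (((((hasDerivAt_inv_axisDist (axisDist_pos h1)).const_mul (-μ)).sub
    ((hasDerivAt_inv_axisDist (axisDist_pos h2)).const_mul (1 - μ))).sub h3).congr_deriv ?_).deriv
  simp only [Prod.mk.eta, verticalFactor]
  ring

lemma u_eq_radialPotential_right {μ a : ℝ} (ha : 0 < a) :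
    u μ (1 - μ + a) = μ * (1 - μ) / 2 -
      (μ * radialPotential a + (1 - μ) * radialPotential (a + 1)) := by
  have h1 : |1 - μ + a - (1 - μ)| = a := by rw [abs_of_pos] <;> linarith
  have h2 : |1 - μ + a + μ| = a + 1 := by rw [abs_of_pos] <;> linarith
  rw [u, h1, h2, radialPotential, radialPotential]
  ring

lemma u_neg (μ x : ℝ) : u μ (-x) = u (1 - μ) x := by
  have h1 : |-x - (1 - μ)| = |x + (1 - μ)| := by rw [← abs_neg]; ring_nf
  have h2 : |-x + μ| = |x - (1 - (1 - μ))| := by rw [← abs_neg]; ring_nf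
  rw [u, u, h1, h2]
  ring

lemma collinear_critical_of_deriv_eq_zero {μ a : ℝ} (ha : 0 < a)
    (h : deriv (u μ) (1 - μ + a) = 0) :
    μ / a ^ 2 + (1 - μ) / (a + 1) ^ 2 = μ * a + (1 - μ) * (a + 1) := by
  have habs : ∀ y x : ℝ, 0 < x - y →
      HasDerivAt (fun t => |t - y|⁻¹) (-1 / (x - y) ^ 2) x := by
    intro y x hxy
    have h1 : HasDerivAt (fun t => (t - y)⁻¹) (-1 / (x - y) ^ 2) x :=
      ((hasDerivAt_id x).sub_const y).inv hxy.ne'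
    refine h1.congr_of_eventuallyEq ?_
    filter_upwards [lt_mem_nhds (sub_pos.1 hxy)] with t ht
    rw [abs_of_pos (sub_pos.2 ht)]
  have hu : u μ = fun x => -μ * |x - (1 - μ)|⁻¹ - (1 - μ) * |x - -μ|⁻¹ - x ^ 2 / 2 := by
    funext x
    simp [u, div_eq_mul_inv]
  have h3 : HasDerivAt (fun t : ℝ => t ^ 2 / 2) (1 - μ + a) (1 - μ + a) := by
    simpa using ((hasDerivAt_id (1 - μ + a)).pow 2).div_const 2
  have hd := (((habs (1 - μ) (1 - μ + a) (by linarith)).const_mul (-μ)).sub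
    ((habs (-μ) (1 - μ + a) (by linarith)).const_mul (1 - μ))).sub h3
  rw [hu] at h
  have h0 := hd.deriv.symm.trans h
  have e1 : 1 - μ + a - (1 - μ) = a := by ring
  have e2 : 1 - μ + a - -μ = a + 1 := by ring
  rw [e1, e2] at h0
  simp only [div_eq_mul_inv] at h0 ⊢
  linarith

/-- Positive exactly on the region bounded by the vanishing of the vertical factor and by the two
circles about the primaries through the outer collinear critical points. -/
noncomputable def barrierFunction (μ a b : ℝ) (q : ℝ × ℝ) : ℝ :=
  min (verticalFactor μ q) (min (a + 1 - axisDist (-μ) q) (b + 1 - axisDist (1 - μ) q))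

lemma continuousOn_barrierFunction (μ a b : ℝ) :
    ContinuousOn (barrierFunction μ a b) {q | q ≠ (1 - μ, 0) ∧ q ≠ (-μ, 0)} := by
  have h1 := (continuous_axisDist (1 - μ)).continuousOn (s := {q | q ≠ (1 - μ, 0) ∧ q ≠ (-μ, 0)})
  have h2 := (continuous_axisDist (-μ)).continuousOn (s := {q | q ≠ (1 - μ, 0) ∧ q ≠ (-μ, 0)})
  have h3 := (h1.pow 3).inv₀ fun q hq => (pow_pos (axisDist_pos hq.1) 3).ne'
  have h4 := (h2.pow 3).inv₀ fun q hq => (pow_pos (axisDist_pos hq.2) 3).ne'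
  exact ContinuousOn.inf (((h3.const_mul μ).add (h4.const_mul (1 - μ))).sub continuousOn_const)
    (ContinuousOn.inf (continuousOn_const.sub h2) (continuousOn_const.sub h1))

lemma one_lt_mul_inv_cube {m r : ℝ} (hm : m < 1) (hr : 0 < r) (hrm : r < m) :
    1 < m * (r ^ 3)⁻¹ := by
  rw [← div_eq_mul_inv, one_lt_div (by positivity)]
  have h : r ^ 2 < 1 := by nlinarith
  nlinarith

lemma barrierFunction_pos_of_near {μ a b : ℝ} (hμ1 : μ < 1) (hb : 0 < b)
    {q : ℝ × ℝ} (h1 : q ≠ (1 - μ, 0)) (hμ : axisDist (1 - μ) q < μ)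
    (ha : axisDist (1 - μ) q < a) : 0 < barrierFunction μ a b q := by
  have htri := axisDist_le_add_one (x := -μ) (y := 1 - μ) (by ring) q
  have h := one_lt_mul_inv_cube hμ1 (axisDist_pos h1) hμ
  have h' : 0 ≤ (1 - μ) * (axisDist (-μ) q ^ 3)⁻¹ :=
    mul_nonneg (by linarith) (inv_nonneg.2 (pow_nonneg (axisDist_nonneg _ _) 3))
  refine lt_min ?_ (lt_min (by linarith) (by linarith))
  rw [verticalFactor]
  linarith

lemma barrierFunction_pos_of_near' {μ a b : ℝ} (hμ0 : 0 < μ) (ha : 0 < a)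
    {q : ℝ × ℝ} (h2 : q ≠ (-μ, 0)) (hμ : axisDist (-μ) q < 1 - μ)
    (hb : axisDist (-μ) q < b) : 0 < barrierFunction μ a b q := by
  have htri := axisDist_le_add_one (x := 1 - μ) (y := -μ) (by ring) q
  have h := one_lt_mul_inv_cube (by linarith) (axisDist_pos h2) hμ
  have h' : 0 ≤ μ * (axisDist (1 - μ) q ^ 3)⁻¹ :=
    mul_nonneg hμ0.le (inv_nonneg.2 (pow_nonneg (axisDist_nonneg _ _) 3))
  refine lt_min ?_ (lt_min (by linarith) (by linarith))
  rw [verticalFactor]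
  linarith

lemma V_ge_of_barrierFunction_eq_zero {μ a b : ℝ} (hμ0 : 0 < μ) (hμ1 : μ < 1)
    (ha : 0 < a) (hb : 0 < b)
    (hcrita : μ / a ^ 2 + (1 - μ) / (a + 1) ^ 2 = μ * a + (1 - μ) * (a + 1))
    (hcritb : (1 - μ) / b ^ 2 + μ / (b + 1) ^ 2 = (1 - μ) * b + μ * (b + 1))
    {q : ℝ × ℝ} (h1 : q ≠ (1 - μ, 0)) (h2 : q ≠ (-μ, 0)) (h : barrierFunction μ a b q = 0) :
    u μ (1 - μ + a) ≤ V μ q ∨ u μ (-(μ + b)) ≤ V μ q := by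
  have hub := u_eq_radialPotential_right (μ := 1 - μ) hb
  rw [sub_sub_cancel, ← u_neg] at hub
  rw [u_eq_radialPotential_right ha, hub, V_eq_radialPotential]
  have ht1 := axisDist_le_add_one (x := 1 - μ) (y := -μ) (by ring) q
  have ht2 := axisDist_le_add_one (x := -μ) (y := 1 - μ) (by ring) q
  have hr1 := axisDist_pos h1
  have hr2 := axisDist_pos h2
  unfold barrierFunction verticalFactor at h
  set r := axisDist (1 - μ) q
  set R := axisDist (-μ) q
  have hg := h.symm.trans_le (min_le_left _ _)
  have hA := (h.symm.trans_le (min_le_right _ _)).trans (min_le_left _ _)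
  have hB := (h.symm.trans_le (min_le_right _ _)).trans (min_le_right _ _)
  have hone : ∀ {x : ℝ}, 1 < x → (x ^ 3)⁻¹ < 1 := fun hx =>
    inv_lt_one_of_one_lt₀ (one_lt_pow₀ hx (by norm_num))
  have hone' : ∀ {x : ℝ}, 0 < x → x ≤ 1 → 1 ≤ (x ^ 3)⁻¹ := fun h0 hx =>
    (one_le_inv₀ (by positivity)).2 (pow_le_one₀ h0.le hx)
  have hone'' : ∀ {x : ℝ}, 0 < x → x < 1 → 1 < (x ^ 3)⁻¹ := fun h0 hx =>
    (one_lt_inv₀ (by positivity)).2 (pow_lt_one₀ h0.le hx (by norm_num))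
  have hzero : μ * (r ^ 3)⁻¹ + (1 - μ) * (R ^ 3)⁻¹ = 1 ∨ R = a + 1 ∨ r = b + 1 := by
    rcases min_choice (μ * (r ^ 3)⁻¹ + (1 - μ) * (R ^ 3)⁻¹ - 1)
      (min (a + 1 - R) (b + 1 - r)) with h' | h'
    · left; linarith
    · rcases min_choice (a + 1 - R) (b + 1 - r) with h'' | h''
      · right; left; linarith
      · right; right; linarith
  have hν : 0 < 1 - μ := by linarith
  rcases le_or_gt r 1 with hr | hr
  · rcases le_or_gt 1 R with hR | hR
    · left
      have := radialPotential_barrier hμ0 hμ1 ha hcrita hr1 hr hR ht2 (by linarith)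
        (by
          rcases hzero with h' | h' | h'
          · exact Or.inr h'
          · exact Or.inl h'
          · linarith)
      linarith
    · exfalso
      rcases hzero with h' | h' | h'
      · nlinarith [mul_le_mul_of_nonneg_left (hone' hr1 hr) hμ0.le,
          mul_lt_mul_of_pos_left (hone'' hr2 hR) hν]
      · linarith
      · linarith
  · rcases le_or_gt R 1 with hR | hR
    · right
      have := radialPotential_barrier (m := 1 - μ) hν (by linarith) hb
        (by rw [sub_sub_cancel]; exact hcritb) hr2 hR hr.le ht1 (by linarith)
        (by
          rw [sub_sub_cancel]
          rcases hzero with h' | h' | h'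
          · right; linarith
          · linarith
          · exact Or.inl h')
      rw [sub_sub_cancel] at this
      linarith
    · exfalso
      nlinarith [mul_lt_mul_of_pos_left (hone hr) hμ0, mul_lt_mul_of_pos_left (hone hR) hν]

/-- Inside the bounded Hill's region, for any energy below the second critical value,
the roots of `∂V/∂q₂` are precisely the points on the `q₁`-axis. -/
theorem Vq2_zeros_in_bounded_Hills_region
    (μ : ℝ) (hμ : μ ∈ Ioo (0 : ℝ) 1)
    (ℓ₂ ℓ₃ : ℝ) (hℓ₂ : ℓ₂ ∈ Ioi (1 - μ)) (hℓ₃ : ℓ₃ ∈ Iio (-μ))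
    (hcrit₂ : deriv (u μ) ℓ₂ = 0)
    (huniq₂ : ∀ x ∈ Ioi (1 - μ), deriv (u μ) x = 0 → x = ℓ₂)
    (hcrit₃ : deriv (u μ) ℓ₃ = 0)
    (huniq₃ : ∀ x ∈ Iio (-μ), deriv (u μ) x = 0 → x = ℓ₃)
    (c : ℝ) (hc₂ : c < u μ ℓ₂) (hc₃ : c < u μ ℓ₃)
    -- `K` is the bounded Hill's region `𝔎_c^b`: a connected component of the Hill's region
    -- whose closure contains one of the primaries
    (K : Set (ℝ × ℝ)) (p : ℝ × ℝ)
    (hK : K = connectedComponentIn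
      {q : ℝ × ℝ | q ≠ (1 - μ, 0) ∧ q ≠ (-μ, 0) ∧ V μ q ≤ c} p)
    (hKbdd : ((1 - μ, 0) : ℝ × ℝ) ∈ closure K ∨ ((-μ, 0) : ℝ × ℝ) ∈ closure K) :
    ∀ q ∈ K, (Vq2 μ q = 0 ↔ q.2 = 0) := by
  obtain ⟨hμ0, hμ1⟩ := hμ
  obtain ⟨a, rfl⟩ : ∃ a, ℓ₂ = 1 - μ + a := ⟨ℓ₂ - (1 - μ), by ring⟩
  obtain ⟨b, rfl⟩ : ∃ b, ℓ₃ = -(μ + b) := ⟨-μ - ℓ₃, by ring⟩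
  have ha : 0 < a := by simpa using hℓ₂
  have hb : 0 < b := by simpa using hℓ₃
  have hcrita := collinear_critical_of_deriv_eq_zero ha hcrit₂
  have hcritb : (1 - μ) / b ^ 2 + μ / (b + 1) ^ 2 = (1 - μ) * b + μ * (b + 1) := by
    have h := collinear_critical_of_deriv_eq_zero (μ := 1 - μ) hb (by
      rw [sub_sub_cancel, ← funext (u_neg μ), deriv_comp_neg, hcrit₃, neg_zero])
    simpa only [sub_sub_cancel] using h
  have hsub : ∀ q ∈ K, q ≠ (1 - μ, 0) ∧ q ≠ (-μ, 0) ∧ V μ q ≤ c := by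
    rw [hK]
    exact connectedComponentIn_subset _ _
  have hconn : IsPreconnected K := hK ▸ isPreconnected_connectedComponentIn
  have hcont : ContinuousOn (barrierFunction μ a b) K :=
    (continuousOn_barrierFunction μ a b).mono fun q hq => ⟨(hsub q hq).1, (hsub q hq).2.1⟩
  have hmeets : ∀ x δ : ℝ, 0 < δ → ((x, 0) : ℝ × ℝ) ∈ closure K →
      ∃ q ∈ K, axisDist x q < δ := by
    intro x δ hδ hx
    obtain ⟨q, hq, hqK⟩ := mem_closure_iff.1 hx {q | axisDist x q < δ}
      (isOpen_lt (continuous_axisDist x) continuous_const) (by simpa [axisDist_self] using hδ)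
    exact ⟨q, hqK, hq⟩
  obtain ⟨q₀, hq₀, hpos⟩ : ∃ q ∈ K, 0 < barrierFunction μ a b q := by
    rcases hKbdd with h | h
    · obtain ⟨q, hq, hd⟩ := hmeets _ (min μ a) (lt_min hμ0 ha) h
      exact ⟨q, hq, barrierFunction_pos_of_near hμ1 hb (hsub q hq).1
        (hd.trans_le (min_le_left _ _)) (hd.trans_le (min_le_right _ _))⟩
    · obtain ⟨q, hq, hd⟩ := hmeets _ (min (1 - μ) b) (lt_min (by linarith) hb) h
      exact ⟨q, hq, barrierFunction_pos_of_near' hμ0 ha (hsub q hq).2.1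
        (hd.trans_le (min_le_left _ _)) (hd.trans_le (min_le_right _ _))⟩
  intro q hq
  have hqpos : 0 < barrierFunction μ a b q := by
    by_contra! hle
    obtain ⟨z, hz, hz0⟩ := hconn.intermediate_value hq hq₀ hcont ⟨hle, hpos.le⟩
    obtain ⟨h1, h2, h3⟩ := hsub z hz
    rcases V_ge_of_barrierFunction_eq_zero hμ0 hμ1 ha hb hcrita hcritb h1 h2 hz0 with h | h <;>
      linarith
  have hg : 0 < verticalFactor μ q := hqpos.trans_le (min_le_left _ _)
  rw [Vq2_eq_mul_verticalFactor (hsub q hq).1 (hsub q hq).2.1, mul_eq_zero]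
  exact or_iff_left hg.ne'
end
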